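/- Let (A, I) be a pair of a commutative ring and an ideal. Then (A, I) is a henselian pair if and only if for every finite A-algebra C, the map Idem(C) → Idem(C/IC) between sets of idempotents is bijective. -/

import Mathlib

open Polynomial in
theorem Polynomial.Monic.exists_injective_map_eq_prod_fin (n : ℕ) :
    ∀ (R : Type u) [CommRing R] (P : R[X]), P.Monic → P.natDegree = n →
      ∃ (B : Type u) (_ : CommRing B) (g : R →+* B) (y : Fin n → B),
        Function.Injective g ∧ P.map g = ∏ i, (X - C (y i)) := by
  induction n with
  | zero =>
    intro R _ P hP hn
    exact ⟨R, inferInstance, RingHom.id R, Fin.elim0, Function.injective_id,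
      by simp [hP.natDegree_eq_zero.mp hn]⟩
  | succ n ih =>
    intro R _ P hP hn
    have : Nontrivial R := by
      by_contra h
      rw [not_nontrivial_iff_subsingleton] at h
      simp [Subsingleton.elim P 0] at hn
    have hinj : Function.Injective (AdjoinRoot.of P) := by
      rw [injective_iff_map_eq_zero]
      intro a ha
      by_contra h0
      rw [← AdjoinRoot.mk_C, AdjoinRoot.mk_eq_zero] at ha
      exact hP.not_dvd_of_natDegree_lt (by simpa using h0) (by simp [hn]) ha
    have : Nontrivial (AdjoinRoot P) := hinj.nontrivial
    obtain ⟨P₁, hP₁⟩ := dvd_iff_isRoot.mpr (AdjoinRoot.isRoot_root P)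
    have hm : P₁.Monic := (monic_X_sub_C _).of_mul_monic_left (hP₁ ▸ hP.map _)
    have hd : P₁.natDegree = n := by
      have := congrArg natDegree hP₁
      rw [hP.natDegree_map, (monic_X_sub_C _).natDegree_mul hm, natDegree_X_sub_C, hn] at this
      omega
    obtain ⟨B, _, g, y, hg, hy⟩ := ih _ P₁ hm hd
    refine ⟨B, inferInstance, g.comp (AdjoinRoot.of P), Fin.cons (g (AdjoinRoot.root P)) y,
      hg.comp hinj, ?_⟩
    rw [← Polynomial.map_map, hP₁, Fin.prod_univ_succ, Polynomial.map_mul, hy]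
    simp

open Polynomial in
/-- A monic polynomial splits into linear factors over some extension ring. -/
theorem Polynomial.Monic.exists_injective_map_eq_prod {R : Type u} [CommRing R] {P : R[X]}
    (hP : P.Monic) {σ : Type*} [Fintype σ] (hσ : P.natDegree = Fintype.card σ) :
    ∃ (B : Type u) (_ : CommRing B) (g : R →+* B) (y : σ → B),
      Function.Injective g ∧ P.map g = ∏ i, (X - C (y i)) := by
  obtain ⟨B, _, g, y, hg, hy⟩ := exists_injective_map_eq_prod_fin _ R P hP hσ
  refine ⟨B, inferInstance, g, y ∘ Fintype.equivFin σ, hg, ?_⟩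
  rw [hy]
  exact ((Fintype.equivFin σ).prod_comp fun i => X - C (y i)).symm

open Polynomial in
/-- A symmetric polynomial takes a universal value on the roots of a monic polynomial. -/
theorem MvPolynomial.IsSymmetric.exists_eval₂_eq {R : Type u} [CommRing R] {σ : Type*} [Fintype σ]
    {f : MvPolynomial σ R} (hf : f.IsSymmetric) (P : R[X]) :
    ∃ r : R, ∀ (S : Type u) [CommRing S] (g : R →+* S) (y : σ → S),
      P.map g = ∏ i, (Polynomial.X - Polynomial.C (y i)) → g r = f.eval₂ g y := by
  obtain ⟨h, hh⟩ := MvPolynomial.esymmAlgHom_surjective R le_rfl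
    (⟨f, (MvPolynomial.mem_symmetricSubalgebra _).mpr hf⟩ : MvPolynomial.symmetricSubalgebra σ R)
  replace hh : MvPolynomial.aeval (fun i : Fin (Fintype.card σ) =>
      MvPolynomial.esymm σ R (i + 1)) h = f := by
    rw [← MvPolynomial.esymmAlgHom_apply, hh]
  refine ⟨MvPolynomial.aeval (fun i : Fin (Fintype.card σ) =>
    (-1) ^ ((i : ℕ) + 1) * P.coeff (Fintype.card σ - (i + 1))) h, fun S _ g y hy => ?_⟩
  let := g.toAlgebra
  change algebraMap R S _ = MvPolynomial.eval₂ (algebraMap R S) y f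
  rw [← MvPolynomial.aeval_def, ← hh, ← MvPolynomial.aeval_algebraMap_apply]
  rw [← AlgHom.comp_apply, MvPolynomial.comp_aeval]
  congr 2
  funext i
  have hi : (i : ℕ) + 1 ≤ Fintype.card σ := i.2
  have key := congrArg (fun p => p.coeff (Fintype.card σ - (i + 1))) hy
  simp only [Polynomial.coeff_map] at key
  have := Multiset.prod_X_sub_C_coeff (Finset.univ.val.map y) (k := Fintype.card σ - (i + 1))
    (by simp)
  rw [Multiset.map_map] at this
  rw [MvPolynomial.aeval_esymm_eq_multiset_esymm, Function.comp_apply, map_mul,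
    RingHom.algebraMap_toAlgebra, key]
  erw [this]
  have h3 : Fintype.card σ - (Fintype.card σ - ((i : ℕ) + 1)) = i + 1 := by omega
  simp [h3, ← mul_assoc, ← mul_pow]

/-- Pairwise products of the `∏ j ≠ i, w j` vanish when `∏ j, w j` does. -/
theorem Finset.prod_erase_mul_prod_erase_eq_zero {ι R : Type*} [Fintype ι] [DecidableEq ι]
    [CommRing R] {w : ι → R} (hw : ∏ i, w i = 0) {i j : ι} (hij : i ≠ j) :
    (∏ k ∈ univ.erase i, w k) * ∏ k ∈ univ.erase j, w k = 0 := by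
  rw [← mul_prod_erase (univ.erase i) w (mem_erase.mpr ⟨hij.symm, mem_univ j⟩), mul_right_comm,
    mul_prod_erase univ w (mem_univ j), hw, zero_mul]

theorem Finset.sum_prod_erase_mul_self {ι R : Type*} [Fintype ι] [DecidableEq ι]
    [CommRing R] {w : ι → R} (hw : ∏ i, w i = 0) (p : ι → Prop) [DecidablePred p] :
    (∑ i with p i, ∏ k ∈ univ.erase i, w k) * (∑ i with p i, ∏ k ∈ univ.erase i, w k) =
      (∑ i, ∏ k ∈ univ.erase i, w k) * ∑ i with p i, ∏ k ∈ univ.erase i, w k := by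
  rw [← sum_filter_add_sum_filter_not univ p, add_mul, left_eq_add, sum_mul_sum]
  refine sum_eq_zero fun i hi => sum_eq_zero fun j hj => prod_erase_mul_prod_erase_eq_zero hw ?_
  rintro rfl
  exact (mem_filter.mp hi).2 (mem_filter.mp hj).2

/-- The product of `y i` over the indices selected by `s` and `1 - y i` over the others. -/
def selectorProd {ι R : Type*} [Fintype ι] [CommRing R] (y : ι → R) (s : ι → Bool) : R :=
  ∏ i, if s i then y i else 1 - y i

theorem map_selectorProd {ι R S F : Type*} [Fintype ι] [CommRing R] [CommRing S] [FunLike F R S]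
    [RingHomClass F R S] (g : F) (y : ι → R) (s : ι → Bool) :
    g (selectorProd y s) = selectorProd (fun i => g (y i)) s := by
  simp [selectorProd, map_prod, apply_ite g]

theorem selectorProd_comp_equiv {ι R : Type*} [Fintype ι] [CommRing R] (y : ι → R)
    (s : ι → Bool) (e : ι ≃ ι) :
    selectorProd (y ∘ e) s = selectorProd y (s ∘ e.symm) := by
  exact Fintype.prod_equiv e _ _ (by simp)

theorem completeOrthogonalIdempotents_selectorProd {ι R : Type*} [Fintype ι] [DecidableEq ι]
    [CommRing R] {y : ι → R} (hy : ∀ i, IsIdempotentElem (y i)) :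
    CompleteOrthogonalIdempotents (selectorProd y) := by
  rw [CompleteOrthogonalIdempotents.iff_ortho_complete]
  constructor
  · intro s t hst
    obtain ⟨i, hi⟩ := Function.ne_iff.mp hst
    simp only [selectorProd, ← Finset.prod_mul_distrib]
    refine Finset.prod_eq_zero (Finset.mem_univ i) ?_
    cases hs : s i <;> cases ht : t i <;> simp_all [mul_sub, sub_mul, (hy i).eq]
  · have := Finset.prod_univ_sum (fun _ : ι => (Finset.univ : Finset Bool))
      (fun i b => if b then y i else 1 - y i)
    simp only [Fintype.piFinset_univ] at this
    simp only [selectorProd, ← this]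
    simp

theorem selectorProd_mul_of_idem {ι R : Type*} [Fintype ι]
    [CommRing R] {y : ι → R} {i : ι} (hy : IsIdempotentElem (y i)) (s : ι → Bool) :
    y i * selectorProd y s = if s i then selectorProd y s else 0 := by
  classical
  rw [selectorProd, ← Finset.mul_prod_erase _ _ (Finset.mem_univ i), ← mul_assoc]
  cases s i <;> simp [mul_sub, hy.eq]

theorem sum_selectorProd {ι R : Type*} [Fintype ι] [DecidableEq ι]
    [CommRing R] {y : ι → R} (hy : ∀ i, IsIdempotentElem (y i)) (i : ι) :
    ∑ s : ι → Bool with s i, selectorProd y s = y i := by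
  have := congrArg (y i * ·) (completeOrthogonalIdempotents_selectorProd hy).complete
  simpa [Finset.mul_sum, selectorProd_mul_of_idem (hy i), Finset.sum_filter] using this

theorem CompleteOrthogonalIdempotents.prod_erase_one_sub {ι R : Type*} [Fintype ι] [DecidableEq ι]
    [CommRing R] {z : ι → R} (hz : CompleteOrthogonalIdempotents z) (i : ι) :
    ∏ j ∈ Finset.univ.erase i, (1 - z j) = z i := by
  rw [hz.toOrthogonalIdempotents.prod_one_sub, sub_eq_iff_eq_add,
    Finset.add_sum_erase _ _ (Finset.mem_univ i), hz.complete]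

open Polynomial in
/-- The polynomial whose roots are the selector products of the roots of `P`. -/
theorem Polynomial.Monic.exists_selector_resolvent {A : Type u} [CommRing A] {ι : Type*}
    [Fintype ι] [DecidableEq ι] {P : A[X]} (hP : P.Monic) (hι : P.natDegree = Fintype.card ι) :
    ∃ Q : A[X], Q.Monic ∧ ∀ (S : Type u) [CommRing S] (g : A →+* S) (y : ι → S),
      P.map g = ∏ i, (X - C (y i)) → Q.map g = ∏ s, (X - C (selectorProd y s)) := by
  have hsymm : MvPolynomial.IsSymmetric (∏ s : ι → Bool,
      (MvPolynomial.C (X : A[X]) - selectorProd (MvPolynomial.X (R := A[X])) s)) := by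
    intro e
    rw [map_prod]
    refine Fintype.prod_equiv (e.arrowCongr (Equiv.refl Bool)) _ _ fun s => ?_
    simp only [map_sub, MvPolynomial.rename_C, map_selectorProd, MvPolynomial.rename_X]
    exact congrArg _ (selectorProd_comp_equiv (MvPolynomial.X (R := A[X])) s e)
  obtain ⟨Q, hQ⟩ := hsymm.exists_eval₂_eq (P.map C)
  have key : ∀ (S : Type u) [CommRing S] (g : A →+* S) (y : ι → S),
      P.map g = ∏ i, (X - C (y i)) → Q.map g = ∏ s, (X - C (selectorProd y s)) := by
    intro S _ g y hy
    have := hQ S[X] (mapRingHom g) (fun i => C (y i)) (by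
      rw [Polynomial.map_map, mapRingHom_comp_C, ← Polynomial.map_map, hy, Polynomial.map_prod]
      simp)
    rw [coe_mapRingHom] at this
    rw [this, ← MvPolynomial.coe_eval₂Hom, map_prod]
    simp only [map_sub, map_selectorProd, MvPolynomial.eval₂Hom_C, MvPolynomial.eval₂Hom_X',
      coe_mapRingHom, map_X]
  refine ⟨Q, ?_, key⟩
  obtain ⟨B, _, g, y, hg, hy⟩ := hP.exists_injective_map_eq_prod hι
  exact monic_of_injective hg (key B g y hy ▸ monic_prod_of_monic _ _ fun _ _ => monic_X_sub_C _)

open Polynomial in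
theorem Polynomial.eval_derivative_prod_X_sub_C {R ι : Type*} [CommRing R] [Fintype ι]
    [DecidableEq ι] (z : ι → R) (u : R) :
    (∏ i, (X - C (z i))).derivative.eval u = ∑ i, ∏ j ∈ Finset.univ.erase i, (u - z j) := by
  simp [derivative_prod_finset, eval_finsetSum, eval_prod]

/-- Idempotent roots, apart from `c`, of `(X ^ 2 - X) ^ (k + 1)`. -/
def idempotentRoots {R : Type*} [CommRing R] (k : ℕ) (c : R) : Option (Fin k × Bool) → R
  | none => 1 - c
  | some (_, b) => if b then 1 else 0

open Polynomial in
theorem prod_X_sub_C_idempotentRoots {R : Type*} [CommRing R] (k : ℕ) {c : R}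
    (hc : IsIdempotentElem c) :
    ∏ i : Option (Option (Fin k × Bool)), (X - C (i.elim c (idempotentRoots k c))) =
      (X ^ 2 - X : R[X]) ^ (k + 1) := by
  have h : (C c : R[X]) * C c = C c := by rw [← C_mul, hc.eq]
  simp only [Fintype.prod_option, Option.elim_none, Option.elim_some, idempotentRoots,
    Fintype.prod_prod_type, Fintype.prod_bool, Finset.prod_const, Finset.card_univ,
    Fintype.card_fin, if_true, C_1, C_sub, Bool.false_eq_true, if_false, C_0]
  rw [pow_succ', ← mul_assoc]
  congr 1
  · linear_combination -h
  · ring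

theorem isIdempotentElem_idempotentRoots {R : Type*} [CommRing R] (k : ℕ) {c : R}
    (hc : IsIdempotentElem c) (i : Option (Option (Fin k × Bool))) :
    IsIdempotentElem (i.elim c (idempotentRoots k c)) := by
  match i with
  | none => exact hc
  | some none => exact hc.one_sub
  | some (some (j, true)) => simp [idempotentRoots, IsIdempotentElem]
  | some (some (j, false)) => simp [idempotentRoots, IsIdempotentElem]

theorem Ideal.isUnit_of_isUnit_mk_of_le_jacobson {A : Type*} [CommRing A] {I : Ideal A}
    (hI : I ≤ Ideal.jacobson ⊥) {a : A} (h : IsUnit (Ideal.Quotient.mk I a)) : IsUnit a :=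
  (isLocalHom_of_le_jacobson_bot I hI).map_nonunit a h

open Polynomial in
theorem HenselianRing.exists_isRoot_selector_resolvent {A : Type u} [CommRing A] {I : Ideal A}
    [hA : HenselianRing A I] {P : A[X]} {k : ℕ} (hP : P.Monic) (hd : P.natDegree = 2 * (k + 1))
    (hPI : P.map (Ideal.Quotient.mk I) = (X ^ 2 - X) ^ (k + 1)) :
    ∃ (Q : A[X]) (u : A), Q.IsRoot u ∧ u - 1 ∈ I ∧ Q.derivative.eval u - 1 ∈ I ∧
      ∀ (S : Type u) [CommRing S] (g : A →+* S) (y : Option (Option (Fin k × Bool)) → S),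
        P.map g = ∏ i, (X - C (y i)) → Q.map g = ∏ s, (X - C (selectorProd y s)) := by
  obtain ⟨Q, hQm, hQ⟩ := hP.exists_selector_resolvent (ι := Option (Option (Fin k × Bool)))
    (by simp [hd]; ring)
  have h0 : IsIdempotentElem (0 : A ⧸ I) := IsIdempotentElem.zero
  have hz := completeOrthogonalIdempotents_selectorProd (isIdempotentElem_idempotentRoots k h0)
  have hQI := hQ (A ⧸ I) (Ideal.Quotient.mk I) _ (hPI.trans (prod_X_sub_C_idempotentRoots k h0).symm)
  have hd1 : Ideal.Quotient.mk I (Q.derivative.eval 1) = 1 := by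
    rw [← Polynomial.eval_map_apply, ← derivative_map, hQI, map_one, eval_derivative_prod_X_sub_C,
      ← hz.complete]
    exact Finset.sum_congr rfl fun s _ => by rw [hz.complete, hz.prod_erase_one_sub]
  obtain ⟨u, hu, hu1⟩ := hA.is_henselian Q hQm 1
    (by
      rw [← Ideal.Quotient.eq_zero_iff_mem, ← Polynomial.eval_map_apply, hQI, map_one, eval_prod]
      simpa using hz.prod_one_sub) (by rw [hd1]; exact isUnit_one)
  refine ⟨Q, u, hu, hu1, ?_, hQ⟩
  rw [← Ideal.Quotient.eq, map_one, ← hd1, Ideal.Quotient.eq]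
  exact Ideal.mem_of_dvd _ (sub_dvd_eval_sub _ _ _) hu1

theorem Ideal.map_le_jacobson_bot_of_isIntegral {A C : Type*} [CommRing A] [CommRing C]
    [Algebra A C] [Algebra.IsIntegral A C] {I : Ideal A} (hI : I ≤ Ideal.jacobson ⊥) :
    I.map (algebraMap A C) ≤ Ideal.jacobson ⊥ := by
  refine le_sInf fun M hM => ?_
  have := hM.2
  rw [Ideal.map_le_iff_le_comap]
  exact hI.trans (sInf_le ⟨bot_le, Ideal.isMaximal_comap_of_isIntegral_of_isMaximal M⟩)

theorem IsIdempotentElem.eq_of_sub_mem_jacobson_bot {C : Type*} [CommRing C] {e f : C}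
    (he : IsIdempotentElem e) (hf : IsIdempotentElem f) (h : e - f ∈ Ideal.jacobson (⊥ : Ideal C)) :
    e = f := by
  have hu : IsUnit ((e - f) * (-(e - f)) + 1) := Ideal.mem_jacobson_bot.mp h _
  rw [← sub_eq_zero, ← hu.mul_right_eq_zero]
  have h1 := he.eq
  have h2 := hf.eq
  linear_combination (-e - 1 + 3 * f) * h1 + (-3 * e + 1 + f) * h2

open Polynomial in
/-- An element idempotent modulo `I` is a root of a monic polynomial congruent to a power of
`X ^ 2 - X`. -/
theorem Ideal.exists_monic_aeval_eq_zero_of_sq_sub_mem {A C : Type*} [CommRing A] [CommRing C]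
    [Algebra A C] [Module.Finite A C] [Nontrivial A] {I : Ideal A} {c : C}
    (hc : c ^ 2 - c ∈ I.map (algebraMap A C)) :
    ∃ (k : ℕ) (P : A[X]), P.Monic ∧ P.natDegree = 2 * (k + 1) ∧
      P.map (Ideal.Quotient.mk I) = (X ^ 2 - X) ^ (k + 1) ∧ aeval c P = 0 := by
  obtain ⟨p, hpm, -, hpI, hp0⟩ :=
    LinearMap.exists_monic_and_natDegree_eq_and_coeff_mem_pow_and_aeval_eq_zero A
      (LinearMap.mulLeft A (c ^ 2 - c)) I (by
        rintro _ ⟨x, rfl⟩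
        rw [Ideal.smul_top_eq_map]
        exact Ideal.mul_mem_right _ _ hc)
  have hpc : aeval (c ^ 2 - c) p = 0 := by
    change aeval (Algebra.lmul A C (c ^ 2 - c)) p = 0 at hp0
    rw [aeval_algHom_apply] at hp0
    simpa using congrArg (· (1 : C)) hp0
  have hmap : p.map (Ideal.Quotient.mk I) = X ^ p.natDegree := by
    ext i
    rw [coeff_map, coeff_X_pow]
    split_ifs with hi
    · rw [hi, hpm.coeff_natDegree, map_one]
    · rw [Ideal.Quotient.eq_zero_iff_mem]
      rcases lt_or_gt_of_ne hi with h | h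
      · exact Ideal.pow_le_self (by omega) (hpI i)
      · rw [coeff_eq_zero_of_natDegree_lt h]
        exact zero_mem _
  have hdeg : (X ^ 2 - X : A[X]).natDegree = 2 := by compute_degree!
  have hmon : (X ^ 2 - X : A[X]).Monic := by monicity!
  refine ⟨p.natDegree, (p * X).comp (X ^ 2 - X), (hpm.mul monic_X).comp hmon (by simp [hdeg]),
    ?_, ?_, ?_⟩
  · rw [natDegree_comp_eq_of_mul_ne_zero] <;>
    simp [hdeg, hpm.natDegree_mul monic_X, hmon.leadingCoeff, (hpm.mul monic_X).leadingCoeff,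
      mul_comm]
  · rw [map_comp, Polynomial.map_mul, hmap]
    simp [pow_succ]
  · simp [aeval_comp, hpc]

/-- The resolvent-type sum of the `selectorProd`s that select the distinguished index. -/
theorem MvPolynomial.isSymmetric_sum_prod_erase_selectorProd {D τ : Type*} [CommRing D] [Fintype τ]
    [DecidableEq τ] (c u : D) :
    MvPolynomial.IsSymmetric (∑ s : Option τ → Bool with s none, ∏ t ∈ Finset.univ.erase s,
      (MvPolynomial.C u -
        selectorProd (fun i => i.elim (MvPolynomial.C c) (MvPolynomial.X (R := D))) t)) := by
  intro σ
  let ε : (Option τ → Bool) ≃ (Option τ → Bool) := σ.optionCongr.arrowCongr (Equiv.refl Bool)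
  have hz s : MvPolynomial.rename σ
      (selectorProd (fun i => i.elim (MvPolynomial.C c) (MvPolynomial.X (R := D))) s) =
      selectorProd (fun i => i.elim (MvPolynomial.C c) (MvPolynomial.X (R := D))) (ε s) := by
    refine Eq.trans ?_ (selectorProd_comp_equiv _ s σ.optionCongr)
    rw [map_selectorProd]
    congr 1
    funext i
    cases i <;> simp
  simp only [map_sum, map_prod, map_sub, MvPolynomial.rename_C, hz]
  refine Finset.sum_equiv ε (fun s => by simp [ε, Equiv.arrowCongr]; rfl) fun s _ => ?_
  exact Finset.prod_equiv ε (by simp) (by simp)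

open Polynomial in
theorem Polynomial.exists_map_eq_sum_prod_erase_selectorProd {D : Type u} {τ : Type*} [CommRing D]
    [Fintype τ] [DecidableEq τ] (P : D[X]) (c u : D) :
    ∃ r : D, ∀ (S : Type u) [CommRing S] (g : D →+* S) (y : τ → S),
      P.map g = ∏ i, (X - C (y i)) →
      g r = ∑ s : Option τ → Bool with s none, ∏ t ∈ Finset.univ.erase s,
        (g u - selectorProd (fun i => i.elim (g c) y) t) := by
  obtain ⟨r, hr⟩ :=
    (MvPolynomial.isSymmetric_sum_prod_erase_selectorProd (τ := τ) c u).exists_eval₂_eq P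
  refine ⟨r, fun S _ g y hy => ?_⟩
  rw [hr S g y hy, ← MvPolynomial.coe_eval₂Hom]
  simp only [map_sum, map_prod, map_sub, map_selectorProd, MvPolynomial.eval₂Hom_C]
  refine Finset.sum_congr rfl fun s _ => Finset.prod_congr rfl fun t _ => ?_
  congr 2
  funext i
  cases i <;> simp

open Polynomial in
theorem HenselianRing.exists_isIdempotentElem_sub_mem {A D : Type u} [CommRing A] [CommRing D]
    [Algebra A D] [Module.Finite A D] {I : Ideal A} [hA : HenselianRing A I] {c : D}
    (hc : c ^ 2 - c ∈ I.map (algebraMap A D)) :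
    ∃ e : D, IsIdempotentElem e ∧ e - c ∈ I.map (algebraMap A D) := by
  cases subsingleton_or_nontrivial D
  · exact ⟨c, Subsingleton.elim _ _, by simp⟩
  have := (algebraMap A D).domain_nontrivial
  obtain ⟨k, P, hPm, hPd, hPI, hPc⟩ := Ideal.exists_monic_aeval_eq_zero_of_sq_sub_mem hc
  obtain ⟨Q, u, hu, hu1, hdu, hQ⟩ := hA.exists_isRoot_selector_resolvent hPm hPd hPI
  have hunit : IsUnit (Q.derivative.eval u) := by
    refine Ideal.isUnit_of_isUnit_mk_of_le_jacobson hA.jac ?_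
    rw [Ideal.Quotient.eq.mpr hdu, map_one]
    exact isUnit_one
  obtain ⟨P₁, hP₁⟩ : X - C c ∣ P.map (algebraMap A D) :=
    dvd_iff_isRoot.mpr (by rwa [IsRoot, eval_map_algebraMap])
  have hm : P₁.Monic := (monic_X_sub_C _).of_mul_monic_left (hP₁ ▸ hPm.map _)
  have hd : P₁.natDegree = Fintype.card (Option (Fin k × Bool)) := by
    have := congrArg natDegree hP₁
    rw [hPm.natDegree_map, (monic_X_sub_C _).natDegree_mul hm, natDegree_X_sub_C, hPd] at this
    simp
    omega
  obtain ⟨r, hr⟩ := P₁.exists_map_eq_sum_prod_erase_selectorProd c (algebraMap A D u)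
    (τ := Option (Fin k × Bool))
  have hprod : ∀ (S : Type u) [CommRing S] (g : D →+* S) (y : Option (Fin k × Bool) → S),
      P₁.map g = ∏ i, (X - C (y i)) →
      (∑ s : Option (Option (Fin k × Bool)) → Bool, ∏ t ∈ Finset.univ.erase s,
        (g (algebraMap A D u) - selectorProd (fun i : Option _ => i.elim (g c) y) t) =
          g (algebraMap A D (Q.derivative.eval u))) ∧
      (∏ t, (g (algebraMap A D u) - selectorProd (fun i : Option _ => i.elim (g c) y) t) = 0) := by
    intro S _ g y hy
    have hPS : P.map (g.comp (algebraMap A D)) =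
        ∏ i : Option _, (X - C (i.elim (g c) y)) := by
      rw [← Polynomial.map_map, hP₁, Polynomial.map_mul, hy]
      simp
    have hQS := hQ S _ _ hPS
    refine ⟨?_, ?_⟩
    · rw [← eval_derivative_prod_X_sub_C, ← hQS, derivative_map, ← RingHom.comp_apply,
        ← RingHom.comp_apply, Polynomial.eval_map_apply]
    · have := congrArg (eval (g.comp (algebraMap A D) u)) hQS
      rw [Polynomial.eval_map_apply, hu.eq_zero, map_zero, eval_prod] at this
      simpa using this.symm
  obtain ⟨v, hv⟩ := (hunit.map (algebraMap A D)).exists_right_inv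
  have hrr : r * r = algebraMap A D (Q.derivative.eval u) * r := by
    obtain ⟨B, _, g, y, hg, hy⟩ := hm.exists_injective_map_eq_prod hd
    obtain ⟨h1, h2⟩ := hprod B g y hy
    apply hg
    rw [map_mul, map_mul, hr B g y hy, ← h1]
    exact Finset.sum_prod_erase_mul_self h2 _
  have hrc : r - c ∈ I.map (algebraMap A D) := by
    have hci : IsIdempotentElem (Ideal.Quotient.mk (I.map (algebraMap A D)) c) := by
      rw [IsIdempotentElem, ← map_mul, Ideal.Quotient.eq, ← pow_two]
      exact hc
    have hu1' : Ideal.Quotient.mk (I.map (algebraMap A D)) (algebraMap A D u) = 1 := by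
      rw [← map_one (Ideal.Quotient.mk _), Ideal.Quotient.eq, ← map_one (algebraMap A D), ← map_sub]
      exact Ideal.mem_map_of_mem _ hu1
    have hPq : P.map ((Ideal.Quotient.mk (I.map (algebraMap A D))).comp (algebraMap A D)) =
        (X ^ 2 - X) ^ (k + 1) := by
      have := congrArg (Polynomial.map
        (Ideal.quotientMap (I.map (algebraMap A D)) (algebraMap A D) Ideal.le_comap_map)) hPI
      rw [Polynomial.map_map, Ideal.quotientMap_comp_mk] at this
      simpa using this
    have h3 := hr _ (Ideal.Quotient.mk (I.map (algebraMap A D)))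
      (idempotentRoots k (Ideal.Quotient.mk _ c)) (by
        apply (monic_X_sub_C (Ideal.Quotient.mk (I.map (algebraMap A D)) c)).isRegular.left
        have := prod_X_sub_C_idempotentRoots k hci
        rw [← hPq, ← Polynomial.map_map, hP₁, Fintype.prod_option] at this
        simpa using this.symm)
    rw [← Ideal.Quotient.eq, h3, hu1']
    have hi := isIdempotentElem_idempotentRoots k hci
    rw [Finset.sum_congr rfl fun s _ =>
      (completeOrthogonalIdempotents_selectorProd hi).prod_erase_one_sub s]
    exact sum_selectorProd hi none
  have hvI : v - 1 ∈ I.map (algebraMap A D) := by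
    have := Ideal.mul_mem_left _ (-v) (Ideal.mem_map_of_mem (algebraMap A D) hdu)
    rw [map_sub, map_one] at this
    convert this using 1
    linear_combination hv
  refine ⟨v * r, ?_, ?_⟩
  · rw [IsIdempotentElem]
    linear_combination v ^ 2 * hrr + v * r * hv
  · convert add_mem (Ideal.mul_mem_right r _ hvI) hrc using 1
    ring

/-- If idempotents lift uniquely along quotients of `A`, then `I` is in the Jacobson radical. -/
theorem Ideal.le_jacobson_bot_of_injective_isIdempotentElem {A : Type u} [CommRing A] {I : Ideal A}
    (h : ∀ (C : Type u) [CommRing C] [Algebra A C] [Module.Finite A C] (e f : C),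
      IsIdempotentElem e → IsIdempotentElem f → e - f ∈ I.map (algebraMap A C) → e = f) :
    I ≤ Ideal.jacobson ⊥ := by
  intro x hx
  rw [Ideal.mem_jacobson_bot]
  intro y
  have h1 : algebraMap A (A ⧸ Ideal.span {x * y + 1}) (x * y + 1) = 0 :=
    Ideal.Quotient.eq_zero_iff_mem.mpr (Ideal.mem_span_singleton_self _)
  have h2 : (0 : A ⧸ Ideal.span {x * y + 1}) = 1 := by
    refine h _ _ _ IsIdempotentElem.zero IsIdempotentElem.one ?_
    convert Ideal.mem_map_of_mem (algebraMap A (A ⧸ Ideal.span {x * y + 1}))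
      (Ideal.mul_mem_right y I hx) using 1
    rw [map_add, map_one] at h1
    linear_combination -h1
  rw [← Ideal.span_singleton_eq_top, ← Ideal.Quotient.subsingleton_iff]
  exact subsingleton_of_zero_eq_one h2

open Polynomial in
theorem Polynomial.Monic.exists_isRoot_of_isIdempotentElem_lift {A : Type u} [CommRing A]
    {I : Ideal A} (hI : I ≤ Ideal.jacobson ⊥) {f : A[X]} (hf : f.Monic)
    (h : ∀ c : AdjoinRoot f, c ^ 2 - c ∈ I.map (algebraMap A (AdjoinRoot f)) →
      ∃ e, IsIdempotentElem e ∧ e - c ∈ I.map (algebraMap A (AdjoinRoot f)))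
    {a₀ : A} (h0 : f.eval a₀ ∈ I) (h1 : IsUnit (Ideal.Quotient.mk I (f.derivative.eval a₀))) :
    ∃ a : A, f.IsRoot a ∧ a - a₀ ∈ I := by
  nontriviality A
  have hfin : Module.Finite A (AdjoinRoot f) := hf.finite_adjoinRoot
  set J := I.map (algebraMap A (AdjoinRoot f)) with hJ
  set T := AdjoinRoot.root f with hT
  obtain ⟨d, hd⟩ : ∃ d, f.natDegree = d + 1 := by
    refine Nat.exists_eq_succ_of_ne_zero fun hd => ?_
    rw [hf.natDegree_eq_zero.mp hd] at h0 h1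
    have : IsUnit (0 : A) :=
      Ideal.isUnit_of_isUnit_mk_of_le_jacobson hI (by simpa using h1)
    exact not_isUnit_zero this
  set g := f /ₘ (X - C a₀) with hg
  have hfg : (X - C a₀) * g + C (f.eval a₀) = f := by
    rw [add_comm, ← modByMonic_X_sub_C_eq_C_eval]
    exact modByMonic_add_div f _
  have hgd : g.natDegree = d := by
    rw [hg, natDegree_divByMonic _ (monic_X_sub_C a₀), natDegree_X_sub_C, hd, Nat.add_sub_cancel]
  have hgm : g.coeff d = 1 := by
    have h2 : g.leadingCoeff = f.leadingCoeff :=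
      leadingCoeff_divByMonic_of_monic (monic_X_sub_C a₀) (by
        rw [degree_X_sub_C, degree_eq_natDegree hf.ne_zero, hd]
        exact_mod_cast Nat.le_add_left 1 d)
    have h3 := h2.trans hf.leadingCoeff
    rwa [Polynomial.leadingCoeff, hgd] at h3
  have hga : f.derivative.eval a₀ = g.eval a₀ := by
    rw [← hfg]
    simp
  obtain ⟨v, hv⟩ := h1.exists_right_inv
  obtain ⟨v, rfl⟩ := Ideal.Quotient.mk_surjective v
  rw [← map_mul, ← map_one (Ideal.Quotient.mk I), Ideal.Quotient.eq] at hv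
  have hTg : (T - algebraMap A _ a₀) * aeval T g ∈ J := by
    have := congrArg (aeval T) hfg
    rw [show aeval T f = 0 by simp [hT, AdjoinRoot.aeval_eq]] at this
    have h2 := Ideal.mem_map_of_mem (algebraMap A (AdjoinRoot f)) h0
    rw [← neg_mem_iff] at h2
    convert h2 using 1
    simp only [map_add, map_mul, map_sub, aeval_X, aeval_C] at this
    linear_combination this
  have hTx (x : AdjoinRoot f) : ∃ y a, x = (T - algebraMap A _ a₀) * y + algebraMap A _ a := by
    obtain ⟨p, rfl⟩ := AdjoinRoot.mk_surjective x
    refine ⟨AdjoinRoot.mk f (p /ₘ (X - C a₀)), p.eval a₀, ?_⟩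
    conv_lhs => rw [← modByMonic_add_div p (X - C a₀), modByMonic_X_sub_C_eq_C_eval]
    rw [map_add, map_mul, map_sub, AdjoinRoot.mk_X, AdjoinRoot.mk_C, AdjoinRoot.mk_C, add_comm]
    rfl
  have hidem : (algebraMap A _ v * aeval T g) ^ 2 - algebraMap A _ v * aeval T g ∈ J := by
    obtain ⟨q, hq⟩ : X - C a₀ ∣ g - C (g.eval a₀) := X_sub_C_dvd_sub_C_eval
    have hq' := congrArg (aeval T) hq
    simp only [map_mul, map_sub, aeval_X, aeval_C] at hq'
    rw [hga] at hv
    convert add_mem (Ideal.mul_mem_left J (algebraMap A _ v ^ 2 * aeval T q) hTg)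
      (Ideal.mul_mem_left J (algebraMap A _ v * aeval T g)
        (Ideal.mem_map_of_mem (algebraMap A (AdjoinRoot f)) hv)) using 1
    simp only [map_sub, map_mul, map_one]
    linear_combination (algebraMap A _ v ^ 2 * aeval T g) * hq'
  obtain ⟨e, he, hev⟩ := h _ hidem
  have hTe : (T - algebraMap A _ a₀) * e ∈ J := by
    convert add_mem (Ideal.mul_mem_left J (T - algebraMap A _ a₀) hev)
      (Ideal.mul_mem_left J (algebraMap A _ v) hTg) using 1
    ring
  obtain ⟨a, ha⟩ : ∃ a : A, a • e = T * e := by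
    let N : Submodule A (AdjoinRoot f) := LinearMap.range (LinearMap.mulRight A e)
    have hN : N ≤ Submodule.span A {e} := by
      refine Submodule.le_of_le_smul_of_le_jacobson_bot (I := I)
        (Module.Finite.iff_fg.mp inferInstance) hI ?_
      rintro _ ⟨x, rfl⟩
      obtain ⟨y, b, rfl⟩ := hTx x
      have : (T - algebraMap A _ a₀) * y * e ∈ I • N := by
        rw [show (T - algebraMap A _ a₀) * y * e =
            LinearMap.mulRight A e ((T - algebraMap A _ a₀) * e * y) by
          rw [LinearMap.mulRight_apply]
          linear_combination (-(T - algebraMap A _ a₀) * y) * he.eq]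
        rw [show N = _ from LinearMap.range_eq_map _, ← Submodule.map_smul'']
        refine Submodule.mem_map_of_mem ?_
        rw [Ideal.smul_top_eq_map]
        exact Ideal.mul_mem_right y _ hTe
      rw [LinearMap.mulRight_apply, add_mul, add_comm, ← Algebra.smul_def]
      exact Submodule.add_mem_sup
        (Submodule.smul_mem _ _ (Submodule.mem_span_singleton_self e)) this
    exact Submodule.mem_span_singleton.mp (hN ⟨T, rfl⟩)
  let l : AdjoinRoot f →ₗ[A] A := (lcoeff A d).comp (AdjoinRoot.modByMonicHom hf)
  have hl {x : AdjoinRoot f} (hx : x ∈ J) : l x ∈ I := by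
    have hx' : x ∈ I • (⊤ : Submodule A (AdjoinRoot f)) := by
      rwa [Ideal.smul_top_eq_map]
    have := Submodule.mem_map_of_mem (f := l) hx'
    rw [Submodule.map_smul''] at this
    exact (Submodule.smul_le.mpr fun b hb n _ => Ideal.mul_mem_right n I hb) this
  have hlg : l (algebraMap A _ v * aeval T g) = v := by
    rw [← Algebra.smul_def, map_smul, hT, AdjoinRoot.aeval_eq]
    simp only [l, LinearMap.comp_apply, AdjoinRoot.modByMonicHom_mk]
    rw [(modByMonic_eq_self_iff hf).mpr (degree_lt_degree (by omega)), lcoeff_apply, hgm]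
    simp
  have hw : IsUnit (l e) := by
    refine Ideal.isUnit_of_isUnit_mk_of_le_jacobson hI ?_
    have := hl hev
    rw [map_sub, hlg, ← Ideal.Quotient.eq] at this
    rw [this]
    refine IsUnit.of_mul_eq_one (Ideal.Quotient.mk I (f.derivative.eval a₀)) ?_
    rw [← map_mul, mul_comm, ← map_one (Ideal.Quotient.mk I), Ideal.Quotient.eq]
    exact hv
  refine ⟨a, ?_, ?_⟩
  · have hpe (p : A[X]) : (p.eval a) • e = aeval T p * e := by
      induction p using Polynomial.induction_on' with
      | add p q hp hq => rw [eval_add, add_smul, hp, hq, map_add, add_mul]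
      | monomial n b =>
        rw [eval_monomial, aeval_monomial, mul_smul, Algebra.smul_def, mul_assoc]
        congr 1
        induction n with
        | zero => simp
        | succ n ih => rw [pow_succ', mul_smul, ih, pow_succ, mul_assoc, ← ha, mul_smul_comm]
    have := congrArg l (hpe f)
    rw [hT, AdjoinRoot.aeval_eq, AdjoinRoot.mk_self, zero_mul, map_zero, map_smul] at this
    exact hw.mul_left_eq_zero.mp this
  · have h2 : (a - a₀) • e ∈ J := by
      convert hTe using 1
      rw [sub_smul, ha, sub_mul, Algebra.smul_def]
    have := hl h2
    rw [map_smul] at this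
    exact (Ideal.unit_mul_mem_iff_mem I hw).mp (by rwa [mul_comm])

/-- Let `(A, I)` be a pair of a commutative ring and an ideal.  Then `(A, I)` is a henselian
pair if and only if for every finite `A`-algebra `C`, the map `Idem(C) → Idem(C/IC)`
between sets of idempotents is bijective. -/
theorem stmt14 (A : Type u) [CommRing A] (I : Ideal A) :
    HenselianRing A I ↔
      ∀ (C : Type u) [CommRing C] [Algebra A C], Module.Finite A C →
        Function.Bijective
          (fun e : {c : C // IsIdempotentElem c} =>
            (⟨Ideal.Quotient.mk (I.map (algebraMap A C)) e.1,
              e.2.map (Ideal.Quotient.mk (I.map (algebraMap A C)))⟩ :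
              {c : C ⧸ I.map (algebraMap A C) // IsIdempotentElem c})) := by
  constructor
  · intro hA C _ _ _
    constructor
    · rintro ⟨e, he⟩ ⟨f, hf⟩ hef
      have hef := Ideal.Quotient.eq.mp (congrArg Subtype.val hef)
      exact Subtype.ext (he.eq_of_sub_mem_jacobson_bot hf
        (Ideal.map_le_jacobson_bot_of_isIntegral hA.jac hef))
    · rintro ⟨c, hc⟩
      obtain ⟨c, rfl⟩ := Ideal.Quotient.mk_surjective c
      rw [IsIdempotentElem, ← map_mul, Ideal.Quotient.eq, ← pow_two] at hc
      obtain ⟨e, he, hec⟩ := HenselianRing.exists_isIdempotentElem_sub_mem hc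
      exact ⟨⟨e, he⟩, Subtype.ext (Ideal.Quotient.eq.mpr hec)⟩
  · intro h
    have hI : I ≤ Ideal.jacobson ⊥ := by
      refine Ideal.le_jacobson_bot_of_injective_isIdempotentElem fun C _ _ _ e f he hf hef => ?_
      exact congrArg Subtype.val
        (@(h C ‹_›).1 ⟨e, he⟩ ⟨f, hf⟩ (Subtype.ext (Ideal.Quotient.eq.mpr hef)))
    refine ⟨hI, fun f hf a₀ h0 h1 => ?_⟩
    refine hf.exists_isRoot_of_isIdempotentElem_lift hI (fun c hc => ?_) h0 h1
    obtain ⟨⟨e, he⟩, hec⟩ := (h (AdjoinRoot f) hf.finite_adjoinRoot).2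
      ⟨Ideal.Quotient.mk _ c, by
        rwa [IsIdempotentElem, ← map_mul, Ideal.Quotient.eq, ← pow_two]⟩
    exact ⟨e, he, Ideal.Quotient.eq.mp (congrArg Subtype.val hec)⟩
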